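/- Let n ≥ 1, s_L > 0, and d > √n/π. Let V : ℝⁿ → ℝⁿ be a smooth ℤⁿ-periodic divergence-free vector field, and let P ∈ ℝⁿ. Suppose (u⁽ᵏ⁾)_{k∈ℕ} is a sequence of smooth ℤⁿ-periodic functions u⁽ᵏ⁾ : ℝⁿ → ℝ with ∫_{[0,1]ⁿ} u⁽ᵏ⁾ dx = 0 which satisfies, with H⁽ᵏ⁾ := s_L ∫_{[0,1]ⁿ} |P + ∇u⁽ᵏ⁾(x)| dx, the iteration scheme −d·s_L·Δu⁽ᵏ⁺¹⁾(x) + V(x)·∇u⁽ᵏ⁺¹⁾(x) = H⁽ᵏ⁾ − s_L|P + ∇u⁽ᵏ⁾(x)| − V(x)·P for all x ∈ ℝⁿ and all k. Then the sequence (u⁽ᵏ⁾) is Cauchy in the H¹ norm on the unit cube: for every ε > 0 there exists K such that for all j, k ≥ K, ∫_{[0,1]ⁿ} (u⁽ʲ⁾ − u⁽ᵏ⁾)² + ‖∇u⁽ʲ⁾ − ∇u⁽ᵏ⁾‖² dx < ε. -/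

import Mathlib

open MeasureTheory Real
open scoped RealInnerProductSpace

noncomputable section

/-- The unit cube `[0,1]ⁿ` in `ℝⁿ`. -/
def cube (n : ℕ) : Set (EuclideanSpace ℝ (Fin n)) :=
  {x | ∀ i, x i ∈ Set.Icc (0:ℝ) 1}

/-- A function on `ℝⁿ` is `ℤⁿ`-periodic if it is invariant under integer translations. -/
def IsZnPeriodic {n : ℕ} {F : Type*} (f : EuclideanSpace ℝ (Fin n) → F) : Prop :=
  ∀ (x : EuclideanSpace ℝ (Fin n)) (z : Fin n → ℤ),
    f (x + (WithLp.equiv 2 (Fin n → ℝ)).symm fun i => (z i : ℝ)) = f x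

/-- The divergence of a vector field: the trace of its Fréchet derivative. -/
def diverg {n : ℕ} (V : EuclideanSpace ℝ (Fin n) → EuclideanSpace ℝ (Fin n))
    (x : EuclideanSpace ℝ (Fin n)) : ℝ :=
  LinearMap.trace ℝ (EuclideanSpace ℝ (Fin n)) (fderiv ℝ V x).toLinearMap

/-- The Laplacian of a scalar function: the divergence of its gradient. -/
def laplacian {n : ℕ} (f : EuclideanSpace ℝ (Fin n) → ℝ)
    (x : EuclideanSpace ℝ (Fin n)) : ℝ :=
  diverg (gradient f) x

section Periodic

variable {n : ℕ} {F : Type*}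

theorem cube_eq_preimage (n : ℕ) :
    cube n = WithLp.ofLp ⁻¹' (Set.univ.pi fun _ => Set.Icc (0:ℝ) 1) := by
  ext x
  simp only [cube, Set.mem_ofPred_eq, Set.mem_preimage, Set.mem_univ_pi]

theorem isCompact_cube (n : ℕ) : IsCompact (cube n) := by
  have h : cube n = (EuclideanSpace.equiv (Fin n) ℝ).toHomeomorph ⁻¹'
      (Set.univ.pi fun _ => Set.Icc (0:ℝ) 1) := cube_eq_preimage n
  rw [h, Homeomorph.isCompact_preimage]
  exact isCompact_univ_pi fun _ => isCompact_Icc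

theorem Continuous.integrableOn_cube [NormedAddCommGroup F] {f : (EuclideanSpace ℝ (Fin n)) → F}
    (hf : Continuous f) : IntegrableOn f (cube n) :=
  hf.continuousOn.integrableOn_compact (isCompact_cube n)

theorem map_restrict_cube (n : ℕ) :
    (volume.restrict (cube n)).map (WithLp.ofLp : (EuclideanSpace ℝ (Fin n)) → Fin n → ℝ) =
      Measure.pi fun _ => volume.restrict (Set.Icc (0:ℝ) 1) := by
  rw [cube_eq_preimage, ((PiLp.volume_preserving_ofLp (Fin n)).restrict_preimage
    (MeasurableSet.univ_pi fun _ => measurableSet_Icc)).map_eq, volume_pi, Measure.restrict_pi_pi]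

instance : IsProbabilityMeasure (volume.restrict (Set.Icc (0:ℝ) 1)) :=
  ⟨by simp⟩

instance (n : ℕ) : IsProbabilityMeasure (volume.restrict (cube n)) := by
  have h : IsProbabilityMeasure ((volume.restrict (cube n)).map
      (WithLp.ofLp : (EuclideanSpace ℝ (Fin n)) → Fin n → ℝ)) := by
    rw [map_restrict_cube]
    infer_instance
  exact (Measure.isProbabilityMeasure_map_iff
    (PiLp.volume_preserving_ofLp (Fin n)).measurable.aemeasurable).1 h

theorem setIntegral_cube_eval (i : Fin n) {g : ℝ → ℝ} (hg : Continuous g) :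
    ∫ x in cube n, g (x i) = ∫ t in Set.Icc (0:ℝ) 1, g t := by
  rw [← integral_comp_eval (μ := fun _ : Fin n => volume.restrict (Set.Icc (0:ℝ) 1)) (i := i)
    hg.aestronglyMeasurable, ← map_restrict_cube, integral_map]
  · exact (PiLp.volume_preserving_ofLp (Fin n)).measurable.aemeasurable
  · exact (hg.comp (continuous_apply i)).aestronglyMeasurable

theorem fundamentalDomain_ae_eq_cube (n : ℕ) :
    ZSpan.fundamentalDomain (EuclideanSpace.basisFun (Fin n) ℝ).toBasis =ᵐ[volume] cube n := by
  have h : (Set.univ.pi fun _ : Fin n => Set.Ico (0:ℝ) 1) =ᵐ[volume]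
      Set.univ.pi fun _ : Fin n => Set.Icc (0:ℝ) 1 :=
    Measure.univ_pi_Ico_ae_eq_Icc (f := fun _ : Fin n => (0:ℝ)) (g := fun _ => 1) |>.trans
      (by simp only [Set.pi_univ_Icc]; rfl)
  have h' := (PiLp.volume_preserving_ofLp (Fin n)).quasiMeasurePreserving.preimage_ae_eq h
  rw [cube_eq_preimage]
  refine Filter.EventuallyEq.trans (Filter.EventuallyEq.of_eq (Set.ext fun x => ?_)) h'
  simp only [ZSpan.mem_fundamentalDomain, Set.mem_preimage, Set.mem_univ_pi,
    OrthonormalBasis.coe_toBasis_repr_apply, EuclideanSpace.basisFun_repr]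

theorem IsZnPeriodic.vadd_span {f : (EuclideanSpace ℝ (Fin n)) → F} (hf : IsZnPeriodic f)
    (v : (Submodule.span ℤ (Set.range (EuclideanSpace.basisFun (Fin n) ℝ).toBasis)).toAddSubgroup)
    (x : EuclideanSpace ℝ (Fin n)) : f (v +ᵥ x) = f x := by
  obtain ⟨v, hv⟩ := v
  rw [Submodule.mem_toAddSubgroup, Module.Basis.mem_span_iff_repr_mem] at hv
  choose z hz using hv
  have : v = (WithLp.equiv 2 (Fin n → ℝ)).symm fun i => (z i : ℝ) := by
    ext i
    simpa using (hz i).symm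
  subst this
  rw [← hf x z, add_comm]
  rfl

theorem setIntegral_cube_add_right {f : (EuclideanSpace ℝ (Fin n)) → ℝ} (hf : IsZnPeriodic f)
    (h : EuclideanSpace ℝ (Fin n)) : ∫ x in cube n, f (x + h) = ∫ x in cube n, f x := by
  have : Countable (Submodule.span ℤ
      (Set.range (EuclideanSpace.basisFun (Fin n) ℝ).toBasis)).toAddSubgroup :=
    inferInstanceAs (Countable (Submodule.span ℤ
      (Set.range (EuclideanSpace.basisFun (Fin n) ℝ).toBasis)))
  have hD := ZSpan.isAddFundamentalDomain' (EuclideanSpace.basisFun (Fin n) ℝ).toBasis volume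
  rw [← setIntegral_congr_set (fundamentalDomain_ae_eq_cube n),
    ← setIntegral_congr_set (fundamentalDomain_ae_eq_cube n)]
  have key := (hD.vadd_of_comm h).setIntegral_eq hD hf.vadd_span
  rw [← key, ← Set.image_vadd,
    (measurePreserving_vadd h volume).setIntegral_image_emb (measurableEmbedding_const_vadd h)]
  simp [add_comm]

theorem Continuous.integral_integral_swap_compact {X Y : Type*} [TopologicalSpace X]
    [TopologicalSpace Y] [MeasurableSpace X] [MeasurableSpace Y] [OpensMeasurableSpace (X × Y)]
    {μ : Measure X} {ν : Measure Y} [SFinite μ] [SFinite ν] [IsFiniteMeasureOnCompacts (μ.prod ν)]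
    {f : X → Y → ℝ} (hf : Continuous f.uncurry) {s : Set X} {t : Set Y}
    (hs : IsCompact s) (ht : IsCompact t) (hst : MeasurableSet (s ×ˢ t)) :
    ∫ x in s, ∫ y in t, f x y ∂ν ∂μ = ∫ y in t, ∫ x in s, f x y ∂μ ∂ν := by
  apply integral_integral_swap
  rw [Measure.prod_restrict]
  exact hf.continuousOn.integrableOn_compact' (hs.prod ht) hst

end Periodic

section Gradient

variable {n : ℕ} {f w : EuclideanSpace ℝ (Fin n) → ℝ}
  {F V : EuclideanSpace ℝ (Fin n) → EuclideanSpace ℝ (Fin n)}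

theorem ContDiff.gradient {m k : WithTop ℕ∞} (hf : ContDiff ℝ k f) (hmk : m + 1 ≤ k) :
    ContDiff ℝ m (gradient f) :=
  (InnerProductSpace.toDual ℝ (EuclideanSpace ℝ (Fin n))).symm.contDiff.comp
    (hf.fderiv_right hmk)

theorem IsZnPeriodic.fderiv (hf : IsZnPeriodic f) : IsZnPeriodic (fderiv ℝ f) := by
  intro x z
  rw [← fderiv_comp_add_right]
  congr 1
  exact funext fun y => hf y z

theorem IsZnPeriodic.gradient (hf : IsZnPeriodic f) : IsZnPeriodic (gradient f) := by
  intro x z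
  simp only [_root_.gradient, hf.fderiv x z]

theorem gradient_sub_of_differentiable {g : EuclideanSpace ℝ (Fin n) → ℝ}
    (hf : Differentiable ℝ f) (hg : Differentiable ℝ g) (x : EuclideanSpace ℝ (Fin n)) :
    gradient (fun y => f y - g y) x = gradient f x - gradient g x := by
  simp only [gradient, fderiv_fun_sub (hf x) (hg x), map_sub]

theorem diverg_sub {G : EuclideanSpace ℝ (Fin n) → EuclideanSpace ℝ (Fin n)}
    {x : EuclideanSpace ℝ (Fin n)} (hF : DifferentiableAt ℝ F x) (hG : DifferentiableAt ℝ G x) :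
    diverg (fun y => F y - G y) x = diverg F x - diverg G x := by
  simp only [diverg, fderiv_fun_sub hF hG, ContinuousLinearMap.toLinearMap_sub, map_sub]

theorem diverg_smul {x : EuclideanSpace ℝ (Fin n)} (hf : DifferentiableAt ℝ f x)
    (hF : DifferentiableAt ℝ F x) :
    diverg (fun y => f y • F y) x = f x * diverg F x + ⟪F x, gradient f x⟫ := by
  rw [real_inner_comm, inner_gradient_left]
  simp only [diverg, fderiv_fun_smul hf hF, ContinuousLinearMap.toLinearMap_add, map_add]
  congr 1
  · exact map_smul _ (f x) _
  · exact LinearMap.trace_smulRight (_root_.fderiv ℝ f x).toLinearMap (F x)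

theorem ContDiff.continuous_diverg (hF : ContDiff ℝ 1 F) : Continuous (diverg F) := by
  have h := hF.continuous_fderiv one_ne_zero
  have h2 : Continuous fun A : EuclideanSpace ℝ (Fin n) →L[ℝ] EuclideanSpace ℝ (Fin n) =>
      LinearMap.trace ℝ (EuclideanSpace ℝ (Fin n)) A.toLinearMap :=
    LinearMap.continuous_of_finiteDimensional
      ((LinearMap.trace ℝ (EuclideanSpace ℝ (Fin n))).comp (ContinuousLinearMap.coeLM ℝ))
  exact h2.comp h

theorem sub_eq_setIntegral_fderiv (hf : ContDiff ℝ 1 f) (x h : EuclideanSpace ℝ (Fin n)) :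
    f (x + h) - f x = ∫ t in Set.Icc (0:ℝ) 1, fderiv ℝ f (x + t • h) h := by
  have hd : ∀ t : ℝ, HasDerivAt (fun t : ℝ => f (x + t • h)) (fderiv ℝ f (x + t • h) h) t := by
    intro t
    have h1 : HasDerivAt (fun t : ℝ => x + t • h) h t := by
      simpa using ((hasDerivAt_id t).smul_const h).const_add x
    exact ((hf.differentiable one_ne_zero) _).hasFDerivAt.comp_hasDerivAt t h1
  have hc : Continuous fun t : ℝ => fderiv ℝ f (x + t • h) h :=
    ((hf.continuous_fderiv one_ne_zero).comp (by fun_prop)).clm_apply continuous_const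
  rw [integral_Icc_eq_integral_Ioc, ← intervalIntegral.integral_of_le zero_le_one,
    intervalIntegral.integral_eq_sub_of_hasDerivAt (fun t _ => hd t) (hc.intervalIntegrable _ _)]
  simp

theorem setIntegral_cube_swap_Icc {φ : EuclideanSpace ℝ (Fin n) → ℝ → ℝ}
    (hφ : Continuous φ.uncurry) :
    ∫ x in cube n, ∫ t in Set.Icc (0:ℝ) 1, φ x t = ∫ t in Set.Icc (0:ℝ) 1, ∫ x in cube n, φ x t :=
  hφ.integral_integral_swap_compact (isCompact_cube n) isCompact_Icc
    ((isCompact_cube n).measurableSet.prod measurableSet_Icc)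

theorem setIntegral_cube_fderiv_basisFun (hf : ContDiff ℝ 1 f) (hper : IsZnPeriodic f)
    (i : Fin n) :
    ∫ x in cube n, fderiv ℝ f x (EuclideanSpace.basisFun (Fin n) ℝ i) = 0 := by
  set e := EuclideanSpace.basisFun (Fin n) ℝ i with he
  have hzero : ∀ x, ∫ t in Set.Icc (0:ℝ) 1, fderiv ℝ f (x + t • e) e = 0 := by
    intro x
    rw [← sub_eq_setIntegral_fderiv hf, sub_eq_zero]
    convert hper x (Pi.single i 1) using 3
    ext j
    by_cases hij : j = i <;> simp [he, Pi.single_apply, hij]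
  have hc : Continuous fun p : EuclideanSpace ℝ (Fin n) × ℝ =>
      fderiv ℝ f (p.1 + p.2 • e) e :=
    ((hf.continuous_fderiv one_ne_zero).comp (by fun_prop)).clm_apply continuous_const
  have hswap := setIntegral_cube_swap_Icc (n := n) (φ := fun x t => fderiv ℝ f (x + t • e) e) hc
  have htrans : ∀ t : ℝ, ∫ x in cube n, fderiv ℝ f (x + t • e) e = ∫ x in cube n, fderiv ℝ f x e :=
    fun t => setIntegral_cube_add_right (f := fun x => fderiv ℝ f x e)
      (fun x z => by simp only [hper.fderiv x z]) (t • e)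
  simp only [hzero, htrans] at hswap
  simpa using hswap.symm

/-- The divergence theorem on the torus. -/
theorem setIntegral_cube_diverg (hF : ContDiff ℝ 1 F) (hper : IsZnPeriodic F) :
    ∫ x in cube n, diverg F x = 0 := by
  have hFi : ∀ i, ContDiff ℝ 1 fun x => F x i := fun i =>
    (EuclideanSpace.proj (𝕜 := ℝ) i).contDiff.comp hF
  have h : ∀ x, diverg F x =
      ∑ i, fderiv ℝ (fun y => F y i) x (EuclideanSpace.basisFun (Fin n) ℝ i) := by
    intro x
    rw [diverg, LinearMap.trace_eq_sum_inner _ (EuclideanSpace.basisFun (Fin n) ℝ)]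
    refine Finset.sum_congr rfl fun i _ => ?_
    have := ((EuclideanSpace.proj (𝕜 := ℝ) i).hasFDerivAt.comp x
      (hF.differentiable one_ne_zero x).hasFDerivAt).fderiv
    rw [show (fun y => F y i) = (EuclideanSpace.proj (𝕜 := ℝ) i) ∘ F from rfl, this]
    simp [EuclideanSpace.inner_single_left]
  simp only [h]
  rw [integral_finsetSum]
  · exact Finset.sum_eq_zero fun i _ => setIntegral_cube_fderiv_basisFun (hFi i)
      (fun x z => by simp only [hper x z]) i
  · exact fun i _ => Continuous.integrableOn_cube
      (((hFi i).continuous_fderiv one_ne_zero).clm_apply continuous_const)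

theorem setIntegral_mul_laplacian (hw : ContDiff ℝ 2 w) (hper : IsZnPeriodic w) :
    ∫ x in cube n, w x * laplacian w x = -∫ x in cube n, ‖gradient w x‖ ^ 2 := by
  have hg : ContDiff ℝ 1 (gradient w) := hw.gradient (by norm_num)
  have hw1 : ContDiff ℝ 1 w := hw.of_le (by norm_num)
  have h := setIntegral_cube_diverg (F := fun x => w x • gradient w x) (hw1.smul hg)
    (fun x z => by simp only [hper x z, hper.gradient x z])
  have h2 : ∀ x, diverg (fun y => w y • gradient w y) x =
      w x * laplacian w x + ‖gradient w x‖ ^ 2 := by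
    intro x
    rw [diverg_smul (hw1.differentiable one_ne_zero x) (hg.differentiable one_ne_zero x),
      real_inner_self_eq_norm_sq, laplacian]
  have hwc := hw.continuous
  have hgc := hg.continuous
  have hlc : Continuous (laplacian w) := hg.continuous_diverg
  simp only [h2] at h
  rw [integral_add (Continuous.integrableOn_cube (by fun_prop))
    (Continuous.integrableOn_cube (by fun_prop))] at h
  linarith

theorem setIntegral_mul_inner_gradient (hw : ContDiff ℝ 1 w) (hper : IsZnPeriodic w)
    (hV : ContDiff ℝ 1 V) (hVper : IsZnPeriodic V) (hVdiv : ∀ x, diverg V x = 0) :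
    ∫ x in cube n, w x * ⟪V x, gradient w x⟫ = 0 := by
  have hd := hw.differentiable one_ne_zero
  have h := setIntegral_cube_diverg (F := fun x => w x ^ 2 • V x) ((hw.pow 2).smul hV)
    (fun x z => by simp only [hper x z, hVper x z])
  have h2 : ∀ x, diverg (fun y => w y ^ 2 • V y) x = 2 * (w x * ⟪V x, gradient w x⟫) := by
    intro x
    rw [diverg_smul (f := fun y => w y ^ 2) ((hd x).pow 2) (hV.differentiable one_ne_zero x),
      hVdiv, mul_zero, zero_add,
      real_inner_comm, inner_gradient_left, real_inner_comm, inner_gradient_left,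
      fderiv_fun_pow 2 (hd x)]
    simp [mul_assoc]
  simp only [h2, integral_const_mul] at h
  linarith

end Gradient

section Poincare

variable {n : ℕ} {f w g : EuclideanSpace ℝ (Fin n) → ℝ}
  {V : EuclideanSpace ℝ (Fin n) → EuclideanSpace ℝ (Fin n)}

theorem sq_integral_le_integral_sq {X : Type*} [MeasurableSpace X] {μ : Measure X}
    [IsProbabilityMeasure μ] {φ : X → ℝ} (hφ : Integrable φ μ)
    (hφ2 : Integrable (fun x => φ x ^ 2) μ) : (∫ x, φ x ∂μ) ^ 2 ≤ ∫ x, φ x ^ 2 ∂μ := by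
  set m := ∫ x, φ x ∂μ with hm
  have h : ∫ x, (2 * m * φ x - m ^ 2) ∂μ ≤ ∫ x, φ x ^ 2 ∂μ :=
    integral_mono ((hφ.const_mul _).sub (integrable_const _)) hφ2
      fun x => by nlinarith [sq_nonneg (φ x - m)]
  rw [integral_sub (hφ.const_mul _) (integrable_const _), integral_const_mul, ← hm] at h
  simp only [integral_const, probReal_univ, one_smul] at h
  linarith

theorem setIntegral_sq_sub_translate_le (hf : ContDiff ℝ 1 f) (hper : IsZnPeriodic f)
    (h : EuclideanSpace ℝ (Fin n)) :
    ∫ x in cube n, (f (x + h) - f x) ^ 2 ≤ ‖h‖ ^ 2 * ∫ x in cube n, ‖gradient f x‖ ^ 2 := by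
  have hfc := hf.continuous
  have hgc : Continuous (gradient f) := (hf.gradient (m := 0) (by norm_num)).continuous
  have hc : Continuous fun p : EuclideanSpace ℝ (Fin n) × ℝ =>
      ‖h‖ ^ 2 * ‖gradient f (p.1 + p.2 • h)‖ ^ 2 := by fun_prop
  have hpt : ∀ x, (f (x + h) - f x) ^ 2 ≤
      ∫ t in Set.Icc (0:ℝ) 1, ‖h‖ ^ 2 * ‖gradient f (x + t • h)‖ ^ 2 := by
    intro x
    have hc1 : Continuous fun t : ℝ => fderiv ℝ f (x + t • h) h :=
      ((hf.continuous_fderiv one_ne_zero).comp (by fun_prop)).clm_apply continuous_const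
    have hc2 : Continuous fun t : ℝ => ‖h‖ ^ 2 * ‖gradient f (x + t • h)‖ ^ 2 := by fun_prop
    rw [sub_eq_setIntegral_fderiv hf]
    refine (sq_integral_le_integral_sq hc1.integrableOn_Icc (hc1.pow 2).integrableOn_Icc).trans ?_
    refine integral_mono (hc1.pow 2).integrableOn_Icc hc2.integrableOn_Icc fun t => ?_
    simp only [← inner_gradient_left]
    rw [← sq_abs, ← mul_pow, mul_comm]
    gcongr
    exact abs_real_inner_le_norm _ _
  have hswap := setIntegral_cube_swap_Icc (n := n)
    (φ := fun x t => ‖h‖ ^ 2 * ‖gradient f (x + t • h)‖ ^ 2) hc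
  have htrans : ∀ t : ℝ, ∫ x in cube n, ‖gradient f (x + t • h)‖ ^ 2 =
      ∫ x in cube n, ‖gradient f x‖ ^ 2 :=
    fun t => setIntegral_cube_add_right (f := fun x => ‖gradient f x‖ ^ 2)
      (fun x z => by simp only [hper.gradient x z]) (t • h)
  calc ∫ x in cube n, (f (x + h) - f x) ^ 2
      ≤ ∫ x in cube n, ∫ t in Set.Icc (0:ℝ) 1, ‖h‖ ^ 2 * ‖gradient f (x + t • h)‖ ^ 2 := by
        refine integral_mono (Continuous.integrableOn_cube (by fun_prop)) ?_ hpt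
        exact (continuous_parametric_integral_of_continuous hc isCompact_Icc).integrableOn_cube
    _ = ‖h‖ ^ 2 * ∫ x in cube n, ‖gradient f x‖ ^ 2 := by
        rw [hswap]
        simp only [integral_const_mul, htrans]
        simp

theorem setIntegral_cube_norm_sub_center_sq (n : ℕ) :
    ∫ x in cube n, ‖x - WithLp.toLp 2 fun _ => (1 / 2 : ℝ)‖ ^ 2 = n / 12 := by
  have h1 : ∫ t in Set.Icc (0:ℝ) 1, (t - 1 / 2) ^ 2 = 1 / 12 := by
    rw [integral_Icc_eq_integral_Ioc, ← intervalIntegral.integral_of_le zero_le_one,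
      intervalIntegral.integral_comp_sub_right (fun t => t ^ 2), integral_pow]
    norm_num
  simp only [EuclideanSpace.norm_sq_eq, PiLp.sub_apply, Real.norm_eq_abs, sq_abs]
  rw [integral_finsetSum _ fun i _ => Continuous.integrableOn_cube (by fun_prop)]
  simp only [setIntegral_cube_eval (g := fun t => (t - 1 / 2) ^ 2) _ (by fun_prop), h1]
  simp [div_eq_mul_inv]

/-- A Poincaré inequality for periodic functions with mean zero. -/
theorem setIntegral_cube_sq_le (hf : ContDiff ℝ 1 f) (hper : IsZnPeriodic f)
    (hmean : ∫ x in cube n, f x = 0) :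
    ∫ x in cube n, f x ^ 2 ≤ n / 24 * ∫ x in cube n, ‖gradient f x‖ ^ 2 := by
  have hfc := hf.continuous
  set c : EuclideanSpace ℝ (Fin n) := WithLp.toLp 2 fun _ => (1 / 2 : ℝ)
  set G := ∫ x in cube n, ‖gradient f x‖ ^ 2
  have hcross : ∫ y in cube n, ∫ x in cube n, f (x + (y - c)) * f x = 0 := by
    rw [Continuous.integral_integral_swap_compact
      (f := fun y x => f (x + (y - c)) * f x) (by unfold Function.uncurry; fun_prop)
      (isCompact_cube n) (isCompact_cube n)
      ((isCompact_cube n).measurableSet.prod (isCompact_cube n).measurableSet)]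
    refine (integral_congr_ae (Filter.Eventually.of_forall fun x => ?_)).trans (integral_zero _ _)
    have h := setIntegral_cube_add_right hper (x - c)
    simp only [integral_mul_const]
    rw [show (fun y => f (x + (y - c))) = fun y => f (y + (x - c)) from
      funext fun y => congrArg f (by abel), h, hmean, zero_mul]
  have hpt : ∀ y, 2 * (∫ x in cube n, f x ^ 2) - 2 * ∫ x in cube n, f (x + (y - c)) * f x ≤
      ‖y - c‖ ^ 2 * G := by
    intro y
    refine le_trans (le_of_eq ?_) (setIntegral_sq_sub_translate_le hf hper (y - c))
    have hsq := setIntegral_cube_add_right (f := fun x => f x ^ 2)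
      (fun x z => by simp only [hper x z]) (y - c)
    have i1 : IntegrableOn (fun x => f (x + (y - c)) ^ 2) (cube n) :=
      Continuous.integrableOn_cube (by fun_prop)
    have i2 : IntegrableOn (fun x => f x ^ 2) (cube n) :=
      Continuous.integrableOn_cube (by fun_prop)
    have i3 : IntegrableOn (fun x => 2 * (f (x + (y - c)) * f x)) (cube n) :=
      Continuous.integrableOn_cube (by fun_prop)
    have he : ∀ x, (f (x + (y - c)) - f x) ^ 2 =
        f (x + (y - c)) ^ 2 + f x ^ 2 - 2 * (f (x + (y - c)) * f x) := fun x => by ring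
    simp only [he]
    rw [integral_sub (Continuous.integrableOn_cube (by fun_prop)) i3, integral_add i1 i2,
      integral_const_mul, hsq]
    ring
  have hcont : Continuous fun y => ∫ x in cube n, f (x + (y - c)) * f x :=
    continuous_parametric_integral_of_continuous
      (f := fun y x => f (x + (y - c)) * f x) (by unfold Function.uncurry; fun_prop)
      (isCompact_cube n)
  have hint := integral_mono (μ := volume.restrict (cube n))
    (Continuous.integrableOn_cube (by fun_prop)) (Continuous.integrableOn_cube (by fun_prop)) hpt
  rw [integral_sub (integrable_const _) (hcont.integrableOn_cube.const_mul 2),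
    integral_const_mul (2:ℝ) fun y => ∫ x in cube n, f (x + (y - c)) * f x,
    integral_mul_const G, hcross,
    setIntegral_cube_norm_sub_center_sq] at hint
  simp only [integral_const, probReal_univ, one_smul] at hint
  linarith

theorem energy_identity {d s c : ℝ} (hs : s ≠ 0) (hw : ContDiff ℝ 2 w) (hper : IsZnPeriodic w)
    (hmean : ∫ x in cube n, w x = 0) (hV : ContDiff ℝ 1 V) (hVper : IsZnPeriodic V)
    (hVdiv : ∀ x, diverg V x = 0) (hg : Continuous g)
    (heq : ∀ x, -(d * s) * laplacian w x + ⟪V x, gradient w x⟫ = c - s * g x) :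
    d * ∫ x in cube n, ‖gradient w x‖ ^ 2 = -∫ x in cube n, w x * g x := by
  have hw1 : ContDiff ℝ 1 w := hw.of_le (by norm_num)
  have hgr : ContDiff ℝ 1 (gradient w) := hw.gradient (by norm_num)
  have hwc := hw.continuous
  have hVc := hV.continuous
  have hgc := hgr.continuous
  have hlc : Continuous (laplacian w) := hgr.continuous_diverg
  have h : ∫ x in cube n, (-(d * s) * (w x * laplacian w x) + w x * ⟪V x, gradient w x⟫) =
      ∫ x in cube n, (c * w x - s * (w x * g x)) :=
    integral_congr_ae (Filter.Eventually.of_forall fun x => by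
      linear_combination w x * heq x)
  rw [integral_add (Continuous.integrableOn_cube (by fun_prop))
      (Continuous.integrableOn_cube (by fun_prop)),
    integral_sub (Continuous.integrableOn_cube (by fun_prop))
      (Continuous.integrableOn_cube (by fun_prop)),
    integral_const_mul, integral_const_mul, integral_const_mul,
    setIntegral_mul_laplacian hw hper, setIntegral_mul_inner_gradient hw1 hper hV hVper hVdiv,
    hmean] at h
  refine mul_left_cancel₀ hs ?_
  linear_combination h

theorem energy_contraction {d s c : ℝ} {p : EuclideanSpace ℝ (Fin n) → EuclideanSpace ℝ (Fin n)}
    (hn : 1 ≤ n) (hs : s ≠ 0) (hd : 0 < d)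
    (hw : ContDiff ℝ 2 w) (hper : IsZnPeriodic w)
    (hmean : ∫ x in cube n, w x = 0) (hV : ContDiff ℝ 1 V) (hVper : IsZnPeriodic V)
    (hVdiv : ∀ x, diverg V x = 0) (hg : Continuous g) (hp : Continuous p)
    (hgp : ∀ x, |g x| ≤ ‖p x‖)
    (heq : ∀ x, -(d * s) * laplacian w x + ⟪V x, gradient w x⟫ = c - s * g x) :
    ∫ x in cube n, ‖gradient w x‖ ^ 2 ≤ n / 24 / d ^ 2 * ∫ x in cube n, ‖p x‖ ^ 2 := by
  have hn' : (0:ℝ) < n := by exact_mod_cast hn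
  have hwc := hw.continuous
  have he := energy_identity hs hw hper hmean hV hVper hVdiv hg heq
  have hP := setIntegral_cube_sq_le (hw.of_le (by norm_num)) hper hmean
  set A := ∫ x in cube n, ‖gradient w x‖ ^ 2
  set B := ∫ x in cube n, ‖p x‖ ^ 2
  set W := ∫ x in cube n, w x ^ 2
  set C : ℝ := n / 24 with hC
  have hC0 : 0 < C := by positivity
  have hineq : -∫ x in cube n, w x * g x ≤ C / (2 * d) * B + d / (2 * C) * W := by
    rw [← integral_neg, ← integral_const_mul, ← integral_const_mul,
      ← integral_add (Continuous.integrableOn_cube (by fun_prop))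
        (Continuous.integrableOn_cube (by fun_prop))]
    refine integral_mono (Continuous.integrableOn_cube (by fun_prop))
      (Continuous.integrableOn_cube (by fun_prop)) fun x => ?_
    have h1 : -(w x * g x) ≤ |w x| * ‖p x‖ := by
      refine (neg_le_abs _).trans ?_
      rw [abs_mul]
      gcongr
      exact hgp x
    have h2 : C / (2 * d) * ‖p x‖ ^ 2 + d / (2 * C) * w x ^ 2 - |w x| * ‖p x‖ =
        (C * ‖p x‖ - d * |w x|) ^ 2 / (2 * C * d) := by
      rw [← sq_abs (w x)]
      field_simp
      ring
    have h3 : 0 ≤ (C * ‖p x‖ - d * |w x|) ^ 2 / (2 * C * d) := by positivity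
    simp only
    linarith
  have h4 : d / (2 * C) * W ≤ d / 2 * A := by
    calc d / (2 * C) * W ≤ d / (2 * C) * (C * A) := by gcongr
      _ = d / 2 * A := by field_simp
  have h5 : d / 2 * A ≤ C / (2 * d) * B := by linarith
  calc A = 2 / d * (d / 2 * A) := by field_simp
    _ ≤ 2 / d * (C / (2 * d) * B) := by gcongr
    _ = C / d ^ 2 * B := by field_simp

end Poincare

section Cauchy

variable {n : ℕ}

theorem setIntegral_cube_norm_sub_sq_le
    {v : ℕ → EuclideanSpace ℝ (Fin n) → EuclideanSpace ℝ (Fin n)}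
    (hv : ∀ k, Continuous (v k)) {q : ℝ} (hq0 : 0 < q) (hq1 : q < 1)
    (h : ∀ k, ∫ x in cube n, ‖v (k + 2) x - v (k + 1) x‖ ^ 2 ≤
      q * ∫ x in cube n, ‖v (k + 1) x - v k x‖ ^ 2) :
    ∃ C, ∀ k m, ∫ x in cube n, ‖v (k + m) x - v k x‖ ^ 2 ≤ C * q ^ k := by
  set A := ∫ x in cube n, ‖v 1 x - v 0 x‖ ^ 2
  have hA : 0 ≤ A := integral_nonneg fun x => by positivity
  have hstep : ∀ k, ∫ x in cube n, ‖v (k + 1) x - v k x‖ ^ 2 ≤ A * q ^ k := by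
    intro k
    induction k with
    | zero => simp [A]
    | succ k ih =>
      refine (h k).trans ?_
      rw [pow_succ, ← mul_assoc, mul_comm]
      gcongr
  obtain ⟨θ, hθ0, hθ⟩ : ∃ θ : ℝ, 0 < θ ∧ (1 + θ) * q < 1 :=
    ⟨(1 - q) / (2 * q), div_pos (by linarith) (by linarith), by field_simp; linarith⟩
  set C := (1 + 1 / θ) * A / (1 - (1 + θ) * q) with hCdef
  have hden : 0 < 1 - (1 + θ) * q := by linarith
  have hC0 : 0 ≤ C := by positivity
  have hC : (1 + 1 / θ) * A + (1 + θ) * q * C = C := by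
    have : C * (1 - (1 + θ) * q) = (1 + 1 / θ) * A := div_mul_cancel₀ _ hden.ne'
    linarith
  refine ⟨C, fun k m => ?_⟩
  induction m generalizing k with
  | zero => simpa using by positivity
  | succ m ih =>
    have hv0 := hv k
    have hv1 := hv (k + 1)
    have hv2 := hv (k + 1 + m)
    rw [show k + (m + 1) = k + 1 + m by ring]
    calc ∫ x in cube n, ‖v (k + 1 + m) x - v k x‖ ^ 2
        ≤ ∫ x in cube n, ((1 + 1 / θ) * ‖v (k + 1) x - v k x‖ ^ 2 +
            (1 + θ) * ‖v (k + 1 + m) x - v (k + 1) x‖ ^ 2) := by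
          refine integral_mono (Continuous.integrableOn_cube (by fun_prop))
            (Continuous.integrableOn_cube (by fun_prop)) fun x => ?_
          have h1 : ‖v (k + 1 + m) x - v k x‖ ≤
              ‖v (k + 1) x - v k x‖ + ‖v (k + 1 + m) x - v (k + 1) x‖ :=
            (norm_sub_le_norm_sub_add_norm_sub _ _ _).trans_eq (add_comm _ _)
          set a := ‖v (k + 1) x - v k x‖
          set b := ‖v (k + 1 + m) x - v (k + 1) x‖
          have h2 : (1 + 1 / θ) * a ^ 2 + (1 + θ) * b ^ 2 - (a + b) ^ 2 =
              (a - θ * b) ^ 2 / θ := by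
            field_simp
            ring
          have h3 : 0 ≤ (a - θ * b) ^ 2 / θ := by positivity
          have h4 : ‖v (k + 1 + m) x - v k x‖ ^ 2 ≤ (a + b) ^ 2 := by gcongr
          simp only
          linarith
      _ ≤ (1 + 1 / θ) * (A * q ^ k) + (1 + θ) * (C * q ^ (k + 1)) := by
          rw [integral_add (Continuous.integrableOn_cube (by fun_prop))
            (Continuous.integrableOn_cube (by fun_prop)), integral_const_mul, integral_const_mul]
          gcongr
          · exact hstep k
          · exact ih (k + 1)
      _ = C * q ^ k := by
          rw [pow_succ]
          linear_combination q ^ k * hC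

end Cauchy

/-- Convergence (Cauchy property in `H¹`) of the iteration scheme for the cell problem of
the viscous G-equation, for `d > √n/π` (Theorem B.1 of the paper). -/
theorem iteration_scheme_cauchy_in_H1
    (n : ℕ) (hn : 1 ≤ n) (sL d : ℝ) (hsL : 0 < sL)
    (hd : Real.sqrt n / Real.pi < d)
    (V : EuclideanSpace ℝ (Fin n) → EuclideanSpace ℝ (Fin n))
    (hVsmooth : ContDiff ℝ (⊤:ℕ∞) V) (hVper : IsZnPeriodic V)
    (hVdiv : ∀ x, diverg V x = 0)
    (P : EuclideanSpace ℝ (Fin n))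
    (u : ℕ → EuclideanSpace ℝ (Fin n) → ℝ)
    (husmooth : ∀ k, ContDiff ℝ (⊤:ℕ∞) (u k))
    (huper : ∀ k, IsZnPeriodic (u k))
    (humean : ∀ k, ∫ x in cube n, u k x = 0)
    (H : ℕ → ℝ)
    (hH : ∀ k, H k = sL * ∫ x in cube n, ‖P + gradient (u k) x‖)
    (hiter : ∀ k x, -(d * sL) * laplacian (u (k+1)) x + ⟪V x, gradient (u (k+1)) x⟫
        = H k - sL * ‖P + gradient (u k) x‖ - ⟪V x, P⟫) :
    ∀ ε > 0, ∃ K : ℕ, ∀ j k : ℕ, K ≤ j → K ≤ k →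
      (∫ x in cube n,
        ((u j x - u k x)^2 + ‖gradient (u j) x - gradient (u k) x‖^2)) < ε := by
  have hn' : (0:ℝ) < n := by exact_mod_cast hn
  have hd0 : 0 < d := lt_of_le_of_lt (by positivity) hd
  set q : ℝ := n / 24 / d ^ 2 with hq
  have hq0 : 0 < q := by positivity
  have hq1 : q < 1 := by
    have h1 : √n < d * π := (div_lt_iff₀ pi_pos).1 hd
    have h2 : (n:ℝ) < (d * π) ^ 2 := (Real.sqrt_lt' (by positivity)).1 h1
    have h3 : π ^ 2 < 24 := by nlinarith [pi_lt_four, pi_pos]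
    rw [hq, div_lt_one (by positivity), div_lt_iff₀ (by norm_num)]
    calc (n:ℝ) < d ^ 2 * π ^ 2 := by rwa [← mul_pow]
      _ ≤ d ^ 2 * 24 := by gcongr
  have husm : ∀ k, ContDiff ℝ 2 (u k) := fun k => (husmooth k).of_le 
    (WithTop.coe_le_coe.2 (le_top : (2 : ℕ∞) ≤ ⊤))
  have hV1 : ContDiff ℝ 1 V := hVsmooth.of_le (by exact_mod_cast (le_top : (1 : ℕ∞) ≤ ⊤))
  have hud : ∀ k, Differentiable ℝ (u k) := fun k => (husm k).differentiable two_ne_zero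
  have hgr : ∀ k, ContDiff ℝ 1 (gradient (u k)) := fun k => (husm k).gradient (by norm_num)
  have hgc : ∀ k, Continuous (gradient (u k)) := fun k => (hgr k).continuous
  have hgd : ∀ k, Differentiable ℝ (gradient (u k)) := fun k => (hgr k).differentiable one_ne_zero
  have hgs : ∀ j k, gradient (fun x => u j x - u k x) =
      fun x => gradient (u j) x - gradient (u k) x := fun j k =>
    funext (gradient_sub_of_differentiable (hud j) (hud k))
  have hper : ∀ j k, IsZnPeriodic fun x => u j x - u k x := fun j k x z => by
    simp only [huper j x z, huper k x z]
  have hmean : ∀ j k, ∫ x in cube n, (u j x - u k x) = 0 := fun j k => by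
    rw [integral_sub (husm j).continuous.integrableOn_cube (husm k).continuous.integrableOn_cube,
      humean, humean, sub_zero]
  have hcontr : ∀ k, ∫ x in cube n, ‖gradient (u (k + 2)) x - gradient (u (k + 1)) x‖ ^ 2 ≤
      q * ∫ x in cube n, ‖gradient (u (k + 1)) x - gradient (u k) x‖ ^ 2 := by
    intro k
    have hc0 := hgc k
    have hc1 := hgc (k + 1)
    have h := energy_contraction (w := fun x => u (k + 2) x - u (k + 1) x)
      (g := fun x => ‖P + gradient (u (k + 1)) x‖ - ‖P + gradient (u k) x‖)
      (p := fun x => gradient (u (k + 1)) x - gradient (u k) x)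
      (c := H (k + 1) - H k) hn hsL.ne' hd0 ((husm _).sub (husm _)) (hper _ _) (hmean _ _)
      hV1 hVper hVdiv (by fun_prop) (by fun_prop)
      (fun x => (abs_norm_sub_norm_le _ _).trans_eq (by congr 1; abel))
      (fun x => by
        rw [laplacian, hgs, diverg_sub (hgd _ x) (hgd _ x), inner_sub_right]
        have h1 := hiter (k + 1) x
        have h0 := hiter k x
        simp only [laplacian, add_assoc, Nat.reduceAdd] at h0 h1 ⊢
        linear_combination h1 - h0)
    simpa only [hgs] using h
  obtain ⟨C, hC⟩ := setIntegral_cube_norm_sub_sq_le hgc hq0 hq1 hcontr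
  have hH1 : ∀ j k, ∫ x in cube n, ((u j x - u k x) ^ 2 +
      ‖gradient (u j) x - gradient (u k) x‖ ^ 2) ≤
      (n / 24 + 1) * ∫ x in cube n, ‖gradient (u j) x - gradient (u k) x‖ ^ 2 := by
    intro j k
    have hcj := hgc j
    have hck := hgc k
    have huj := (husm j).continuous
    have huk := (husm k).continuous
    have h := setIntegral_cube_sq_le (((husm j).sub (husm k)).of_le (by norm_num))
      (hper j k) (hmean j k)
    rw [hgs] at h
    rw [integral_add (Continuous.integrableOn_cube (by fun_prop))
      (Continuous.integrableOn_cube (by fun_prop))]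
    linarith
  intro ε hε
  have hlim : Filter.Tendsto (fun k => ((n:ℝ) / 24 + 1) * (C * q ^ k)) Filter.atTop (nhds 0) := by
    simpa using ((tendsto_pow_atTop_nhds_zero_of_lt_one hq0.le hq1).const_mul C).const_mul
      ((n:ℝ) / 24 + 1)
  obtain ⟨K, hK⟩ := Filter.eventually_atTop.1 (hlim.eventually_lt_const hε)
  have hle : ∀ j k, K ≤ k → k ≤ j → ∫ x in cube n, ((u j x - u k x) ^ 2 +
      ‖gradient (u j) x - gradient (u k) x‖ ^ 2) < ε := by
    intro j k hk hkj
    obtain ⟨m, rfl⟩ := Nat.exists_eq_add_of_le hkj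
    refine ((hH1 _ _).trans ?_).trans_lt (hK k hk)
    gcongr
    exact hC k m
  refine ⟨K, fun j k hj hk => ?_⟩
  rcases le_total k j with hkj | hjk
  · exact hle j k hk hkj
  · have h := hle k j hj hjk
    simp only [norm_sub_rev (gradient (u k) _)] at h
    simpa only [sub_sq_comm (u k _)] using h

end
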